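/- Let N ≥ 2, let ρ₁, …, ρ_N > 0, fix i ∈ {1,…,N}, and set R_i := (Σ_{k ≠ i} ρ_k)/ρ_i. Then the following are equivalent: (1) there exist functions v₁, …, v_N : [0,∞) → ℝ, each continuous on [0,∞) and twice continuously differentiable with v_j''(x) + f(v_j(x)) = 0 and 0 < v_j(x) < 1 for all x ≥ 0, such that v₁(0) = ⋯ = v_N(0), Σ_{j=1}^N ρ_j v_j'(0) = 0 (Kirchhoff condition, with one-sided derivatives at 0 taken into each edge), v_i(x) → 1 as x → ∞, and v_j(x) → 0 as x → ∞ for every j ≠ i; (2) F(1) + (R_i² − 1)·F(a) ≤ 0. -/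

import Mathlib

open Set Filter Topology

/-- The primitive `F(s) = ∫₀^s f(r) dr`. -/
noncomputable def F (f : ℝ → ℝ) (s : ℝ) : ℝ := ∫ r in (0:ℝ)..s, f r

/-- Bistable nonlinearity with balanced-positive integral. -/
def Bistable (f : ℝ → ℝ) (a : ℝ) : Prop :=
  ContDiff ℝ 1 f ∧ 0 < a ∧ a < 1 ∧
  f 0 = 0 ∧ f a = 0 ∧ f 1 = 0 ∧
  (∀ s, 0 < s → s < a → f s < 0) ∧
  (∀ s, a < s → s < 1 → 0 < f s) ∧
  deriv f 0 < 0 ∧ 0 < deriv f a ∧ deriv f 1 < 0 ∧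
  0 < ∫ s in (0:ℝ)..(1:ℝ), f s

theorem hasDerivAt_F {f : ℝ → ℝ} (hf : Continuous f) (s : ℝ) : HasDerivAt (F f) (f s) s :=
  intervalIntegral.integral_hasDerivAt_right (hf.intervalIntegrable _ _)
    (hf.stronglyMeasurableAtFilter _ _) hf.continuousAt

/-- A convergent solution of `v'' = -h(v)` on the half-line has vanishing kinetic energy at
infinity, so its initial slope is determined up to sign by the potential `G`. -/
theorem sq_slope_eq_of_tendsto {G h v w : ℝ → ℝ} {ℓ : ℝ} (hG : ∀ s, HasDerivAt G (h s) s)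
    (hv : ∀ x, 0 ≤ x → HasDerivWithinAt v (w x) (Ici 0) x)
    (hw : ∀ x, 0 ≤ x → HasDerivWithinAt w (-h (v x)) (Ici 0) x)
    (hlim : Tendsto v atTop (𝓝 ℓ)) :
    w 0 ^ 2 = 2 * (G ℓ - G (v 0)) := by
  have hE : ∀ x, 0 ≤ x →
      HasDerivWithinAt (fun x => w x ^ 2 + 2 * G (v x)) 0 (Ici 0) x := by
    intro x hx
    have h1 := ((hw x hx).pow 2).add
      (((hG (v x)).comp_hasDerivWithinAt x (hv x hx)).const_mul 2)
    refine h1.congr_deriv ?_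
    simp
    ring
  have hconst : ∀ x, 0 ≤ x → w x ^ 2 + 2 * G (v x) = w 0 ^ 2 + 2 * G (v 0) := by
    intro x hx
    refine constant_of_has_deriv_right_zero (f := fun x => w x ^ 2 + 2 * G (v x))
      (a := 0) (b := x) ?_ ?_ x ⟨hx, le_rfl⟩
    · intro y hy
      exact ((hE y hy.1).continuousWithinAt).mono Icc_subset_Ici_self
    · intro y hy
      exact (hE y hy.1).mono (Ici_subset_Ici.2 hy.1)
  have hmvt : ∀ n : ℕ, ∃ y ∈ Ioo (n : ℝ) (n + 1), w y = v (n + 1) - v n := by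
    intro n
    have hn : (0 : ℝ) ≤ n := n.cast_nonneg
    obtain ⟨y, hy, hy'⟩ := exists_hasDerivAt_eq_slope v w (lt_add_one (n : ℝ))
      (fun y hy => ((hv y (hn.trans hy.1)).continuousWithinAt).mono
        (fun z hz => hn.trans hz.1))
      (fun y hy => (hv y (hn.trans hy.1.le)).hasDerivAt (Ici_mem_nhds (hn.trans_lt hy.1)))
    refine ⟨y, hy, ?_⟩
    rw [hy']
    simp
  choose y hy hwy using hmvt
  have hcast : Tendsto (fun n : ℕ => (n : ℝ)) atTop atTop := tendsto_natCast_atTop_atTop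
  have hy_top : Tendsto y atTop atTop := tendsto_atTop_mono (fun n => (hy n).1.le) hcast
  have hw0 : Tendsto (fun n => w (y n)) atTop (𝓝 0) := by
    have h1 : Tendsto (fun n : ℕ => v ((n : ℝ) + 1) - v n) atTop (𝓝 (ℓ - ℓ)) :=
      (hlim.comp (tendsto_atTop_add_const_right _ 1 hcast)).sub (hlim.comp hcast)
    simpa [hwy] using h1
  have hlim1 : Tendsto (fun n => w (y n) ^ 2 + 2 * G (v (y n))) atTop
      (𝓝 (0 ^ 2 + 2 * G ℓ)) :=
    (hw0.pow 2).add
      ((((hG ℓ).continuousAt.tendsto).comp (hlim.comp hy_top)).const_mul 2)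
  have hlim2 : Tendsto (fun n => w (y n) ^ 2 + 2 * G (v (y n))) atTop
      (𝓝 (w 0 ^ 2 + 2 * G (v 0))) := by
    refine tendsto_const_nhds.congr (fun n => ?_)
    exact (hconst _ ((Nat.cast_nonneg n).trans (hy n).1.le)).symm
  have := tendsto_nhds_unique hlim1 hlim2
  linarith

/-- A scalar autonomous equation `v' = g(v)` with `g > 0` on `(α, β)` and `g` at most linear at
the zero `β` has a global forward solution converging to `β`. -/
theorem exists_forward_solution {g : ℝ → ℝ} {α θ β C : ℝ} (hα : α < θ) (hβ : θ < β)
    (hg : Continuous g) (hpos : ∀ s ∈ Ioo α β, 0 < g s)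
    (hle : ∀ s ∈ Ico θ β, g s ≤ C * (β - s)) :
    ∃ v : ℝ → ℝ, v 0 = θ ∧ (∀ x, 0 ≤ x → HasDerivAt v (g (v x)) x) ∧
      (∀ x, 0 ≤ x → v x ∈ Ioo α β) ∧ Tendsto v atTop (𝓝 β) := by
  have hθ : θ ∈ Ioo α β := ⟨hα, hβ⟩
  have hC : 0 < C := by
    have h1 := (hpos θ hθ).trans_le (hle θ ⟨le_rfl, hβ⟩)
    exact pos_of_mul_pos_left h1 (sub_pos.2 hβ).le
  have hcont : ContinuousOn (fun s => (g s)⁻¹) (Ioo α β) :=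
    hg.continuousOn.inv₀ (fun s hs => (hpos s hs).ne')
  set T : ℝ → ℝ := fun s => ∫ r in θ..s, (g r)⁻¹ with hT
  have hTd : ∀ s ∈ Ioo α β, HasStrictDerivAt T (g s)⁻¹ s := by
    intro s hs
    refine intervalIntegral.integral_hasStrictDerivAt_right ?_ ?_ ?_
    · exact (hcont.mono (ordConnected_Ioo.uIcc_subset hθ hs)).intervalIntegrable
    · exact hcont.stronglyMeasurableAtFilter isOpen_Ioo s hs
    · exact hcont.continuousAt (isOpen_Ioo.mem_nhds hs)
  have hTc : ContinuousOn T (Ioo α β) :=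
    fun s hs => (hTd s hs).hasDerivAt.continuousAt.continuousWithinAt
  have hTmono : StrictMonoOn T (Ioo α β) := by
    refine strictMonoOn_of_deriv_pos (convex_Ioo _ _) hTc (fun s hs => ?_)
    rw [interior_Ioo] at hs
    rw [(hTd s hs).hasDerivAt.deriv]
    exact inv_pos.2 (hpos s hs)
  have hT0 : T θ = 0 := by simp [hT]
  have hsub : Ico θ β ⊆ Ioo α β := fun s hs => ⟨hα.trans_le hs.1, hs.2⟩
  have hlog : MonotoneOn (fun s => T s + C⁻¹ * Real.log (β - s)) (Ico θ β) := by
    have hd : ∀ s ∈ Ico θ β, HasDerivAt (fun s => T s + C⁻¹ * Real.log (β - s))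
        ((g s)⁻¹ + C⁻¹ * (-1 / (β - s))) s := by
      intro s hs
      exact (hTd s (hsub hs)).hasDerivAt.add
        ((((hasDerivAt_id s).const_sub β).log (sub_pos.2 hs.2).ne').const_mul _)
    refine monotoneOn_of_deriv_nonneg (convex_Ico _ _)
      (fun s hs => (hd s hs).continuousAt.continuousWithinAt)
      (fun s hs => (hd s (interior_subset hs)).differentiableAt.differentiableWithinAt)
      (fun s hs => ?_)
    have hs := interior_subset hs
    rw [(hd s hs).deriv]
    have h1 := inv_anti₀ (hpos s (hsub hs)) (hle s hs)
    rw [mul_inv] at h1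
    have : C⁻¹ * (-1 / (β - s)) = -(C⁻¹ * (β - s)⁻¹) := by ring
    rw [this]
    linarith
  have hsurj : ∀ x, 0 ≤ x → ∃ s ∈ Ico θ β, T s = x := by
    intro x hx
    set b := β - (β - θ) * Real.exp (-(C * x)) with hb
    have hd : 0 < β - θ := sub_pos.2 hβ
    have hexp : Real.exp (-(C * x)) ≤ 1 := by
      rw [Real.exp_le_one_iff]
      have := mul_nonneg hC.le hx
      linarith
    have hbm : b ∈ Ico θ β := by
      constructor
      · have := mul_le_mul_of_nonneg_left hexp hd.le
        linarith
      · have := mul_pos hd (Real.exp_pos (-(C * x)))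
        linarith
    have h1 := hlog ⟨le_rfl, hβ⟩ hbm hbm.1
    have h2 : β - b = (β - θ) * Real.exp (-(C * x)) := by rw [hb]; ring
    simp only [h2, hT0, Real.log_mul hd.ne' (Real.exp_pos _).ne', Real.log_exp] at h1
    have h3 : x ≤ T b := by
      have : C⁻¹ * (Real.log (β - θ) + -(C * x)) = C⁻¹ * Real.log (β - θ) - x := by
        field_simp
        ring
      rw [this] at h1
      linarith
    have hIcc : Icc θ b ⊆ Ico θ β := fun s hs => ⟨hs.1, hs.2.trans_lt hbm.2⟩
    obtain ⟨s, hs, hsx⟩ := intermediate_value_Icc hbm.1 (hTc.mono (hIcc.trans hsub))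
      (show x ∈ Icc (T θ) (T b) from ⟨hT0 ▸ hx, h3⟩)
    exact ⟨s, hIcc hs, hsx⟩
  set v : ℝ → ℝ := Function.invFunOn T (Ioo α β) with hvdef
  have hvT : ∀ s ∈ Ioo α β, v (T s) = s := fun s hs =>
    hTmono.injOn.leftInvOn_invFunOn hs
  have hv : ∀ x, 0 ≤ x → v x ∈ Ioo α β ∧ T (v x) = x := by
    intro x hx
    obtain ⟨s, hs, rfl⟩ := hsurj x hx
    rw [hvT s (hsub hs)]
    exact ⟨hsub hs, rfl⟩
  refine ⟨v, ?_, ?_, fun x hx => (hv x hx).1, ?_⟩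
  · rw [← hT0, hvT θ hθ]
  · intro x hx
    obtain ⟨hm, hx'⟩ := hv x hx
    have h1 := (hTd _ hm).to_local_left_inverse (inv_pos.2 (hpos _ hm)).ne'
      (g := v) (by
        filter_upwards [isOpen_Ioo.mem_nhds hm] with s hs using hvT s hs)
    rw [hx', inv_inv] at h1
    exact h1.hasDerivAt
  · rw [tendsto_order]
    constructor
    · intro c hc
      have hm : max c θ ∈ Ico θ β := ⟨le_max_right _ _, max_lt hc hβ⟩
      filter_upwards [eventually_gt_atTop (T (max c θ)), eventually_ge_atTop 0] with x hx hx0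
      obtain ⟨hxm, hx'⟩ := hv x hx0
      rw [← hx'] at hx
      exact (le_max_left _ _).trans_lt ((hTmono.lt_iff_lt (hsub hm) hxm).1 hx)
    · intro c hc
      filter_upwards [eventually_ge_atTop 0] with x hx0
      exact (hv x hx0).1.2.trans hc

/-- Existence of the monotone connection from `θ` up to the critical point `β` of the potential
`G`, for the equation `v'' = -h(v)` with `G' = h`. -/
theorem exists_monotone_profile {G h : ℝ → ℝ} {α θ β K : ℝ} (hα : α < θ) (hβ : θ < β)
    (hG : ∀ s, HasDerivAt G (h s) s) (hpos : ∀ s ∈ Ioo α β, G s < G β)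
    (hle : ∀ s ∈ Ico θ β, G β - G s ≤ K * (β - s) ^ 2) :
    ∃ v w : ℝ → ℝ, v 0 = θ ∧ w 0 = √(2 * (G β - G θ)) ∧
      (∀ x, 0 ≤ x → HasDerivAt v (w x) x) ∧
      (∀ x, 0 ≤ x → HasDerivAt w (-h (v x)) x) ∧
      (∀ x, 0 ≤ x → v x ∈ Ioo α β) ∧ Tendsto v atTop (𝓝 β) := by
  have hGc : Continuous G := continuous_iff_continuousAt.2 fun s => (hG s).continuousAt
  obtain ⟨v, hv0, hv, hm, hlim⟩ := exists_forward_solution (g := fun s => √(2 * (G β - G s)))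
    (C := √(2 * K)) hα hβ (by fun_prop)
    (fun s hs => Real.sqrt_pos.2 (by have := hpos s hs; linarith))
    (fun s hs => by
      have h0 : 0 ≤ β - s := sub_nonneg.2 hs.2.le
      have h1 : √((β - s) ^ 2) = β - s := Real.sqrt_sq h0
      rw [← h1, ← Real.sqrt_mul' _ (sq_nonneg _)]
      refine Real.sqrt_le_sqrt ?_
      have := hle s hs
      linarith)
  refine ⟨v, fun x => √(2 * (G β - G (v x))), hv0, by simp only [hv0], hv, ?_, hm, hlim⟩
  intro x hx
  have hp : 0 < 2 * (G β - G (v x)) := by have := hpos _ (hm x hx); linarith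
  have h1 := ((((hG (v x)).comp x (hv x hx)).const_sub (G β)).const_mul 2).sqrt hp.ne'
  refine h1.congr_deriv ?_
  have := (Real.sqrt_pos.2 hp).ne'
  simp only [Function.comp_apply]
  field_simp

theorem derivWithin_eq_and_contDiffOn_two {f v w : ℝ → ℝ} (hf : Continuous f)
    (hv : ∀ x, 0 ≤ x → HasDerivAt v (w x) x) (hw : ∀ x, 0 ≤ x → HasDerivAt w (-f (v x)) x) :
    ContDiffOn ℝ 2 v (Ici 0) ∧ derivWithin v (Ici 0) 0 = w 0 ∧
      ∀ x, 0 ≤ x → derivWithin (derivWithin v (Ici 0)) (Ici 0) x + f (v x) = 0 := by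
  have hu : UniqueDiffOn ℝ (Ici (0 : ℝ)) := uniqueDiffOn_Ici 0
  have h1 : ∀ x ∈ Ici (0 : ℝ), derivWithin v (Ici 0) x = w x := fun x hx =>
    (hv x hx).hasDerivWithinAt.derivWithin (hu x hx)
  have h2 : ∀ x ∈ Ici (0 : ℝ), derivWithin w (Ici 0) x = -f (v x) := fun x hx =>
    (hw x hx).hasDerivWithinAt.derivWithin (hu x hx)
  have hvc : ContinuousOn v (Ici 0) := fun x hx => (hv x hx).continuousAt.continuousWithinAt
  refine ⟨?_, h1 0 self_mem_Ici, fun x hx => ?_⟩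
  · rw [show (2 : WithTop ℕ∞) = 1 + 1 by norm_num, contDiffOn_succ_iff_derivWithin hu]
    refine ⟨fun x hx => (hv x hx).differentiableAt.differentiableWithinAt, by simp, ?_⟩
    refine ContDiffOn.congr ?_ h1
    rw [show (1 : WithTop ℕ∞) = 0 + 1 by norm_num, contDiffOn_succ_iff_derivWithin hu]
    refine ⟨fun x hx => (hw x hx).differentiableAt.differentiableWithinAt, by simp, ?_⟩
    exact (contDiffOn_zero.2 (hf.comp_continuousOn hvc).neg).congr h2
  · rw [derivWithin_congr h1 (h1 x hx), h2 x hx]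
    ring

/-- The primitive is quadratically flat at a zero of `f`. -/
theorem exists_F_sub_le_sq {f : ℝ → ℝ} (hf : ContDiff ℝ 1 f) {β : ℝ} (hβ : β ∈ Icc (0 : ℝ) 1)
    (h0 : f β = 0) : ∃ K, ∀ s ∈ Icc (0 : ℝ) 1, F f β - F f s ≤ K * (β - s) ^ 2 := by
  obtain ⟨K, hK⟩ := isCompact_Icc.exists_bound_of_continuousOn
    (s := Icc (0 : ℝ) 1) (hf.continuous_deriv le_rfl).continuousOn
  have hK0 : 0 ≤ K := (norm_nonneg _).trans (hK β hβ)
  have hlip : ∀ s ∈ Icc (0 : ℝ) 1, ‖f s‖ ≤ K * ‖s - β‖ := by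
    intro s hs
    have := (convex_Icc (0 : ℝ) 1).norm_image_sub_le_of_norm_deriv_le
      (fun x _ => (hf.differentiable one_ne_zero) x) hK hβ hs
    rwa [h0, sub_zero] at this
  refine ⟨K, fun s hs => ?_⟩
  have hsub : uIcc s β ⊆ Icc 0 1 := ordConnected_Icc.uIcc_subset hs hβ
  have := (convex_uIcc s β).norm_image_sub_le_of_norm_hasDerivWithin_le
    (f := F f) (f' := f) (C := K * ‖s - β‖)
    (fun x _ => (hasDerivAt_F hf.continuous x).hasDerivWithinAt)
    (fun x hx => (hlip x (hsub hx)).trans (mul_le_mul_of_nonneg_left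
      (by rw [norm_sub_rev, norm_sub_rev s]; exact abs_sub_right_of_mem_uIcc hx) hK0)) left_mem_uIcc right_mem_uIcc
  refine (le_abs_self _).trans (this.trans_eq ?_)
  rw [Real.norm_eq_abs, Real.norm_eq_abs, abs_sub_comm s β, mul_assoc, abs_mul_abs_self]
  ring

theorem strictAntiOn_F {f : ℝ → ℝ} {a : ℝ} (hf : Bistable f a) :
    StrictAntiOn (F f) (Icc 0 a) := by
  obtain ⟨hc, -, -, -, -, -, hneg, -⟩ := hf
  refine strictAntiOn_of_deriv_neg (convex_Icc _ _)
    (fun s _ => (hasDerivAt_F hc.continuous s).continuousAt.continuousWithinAt) (fun s hs => ?_)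
  rw [interior_Icc] at hs
  rw [(hasDerivAt_F hc.continuous s).deriv]
  exact hneg s hs.1 hs.2

theorem strictMonoOn_F {f : ℝ → ℝ} {a : ℝ} (hf : Bistable f a) :
    StrictMonoOn (F f) (Icc a 1) := by
  obtain ⟨hc, -, -, -, -, -, -, hpos, -⟩ := hf
  refine strictMonoOn_of_deriv_pos (convex_Icc _ _)
    (fun s _ => (hasDerivAt_F hc.continuous s).continuousAt.continuousWithinAt) (fun s hs => ?_)
  rw [interior_Icc] at hs
  rw [(hasDerivAt_F hc.continuous s).deriv]
  exact hpos s hs.1 hs.2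

theorem F_zero (f : ℝ → ℝ) : F f 0 = 0 := by simp [F]

theorem F_lt_F_one {f : ℝ → ℝ} {a : ℝ} (hf : Bistable f a) {s : ℝ} (hs : s ∈ Ioo (0 : ℝ) 1) :
    F f s < F f 1 := by
  have h1 : 0 < F f 1 := hf.2.2.2.2.2.2.2.2.2.2.2
  have ha0 := hf.2.1
  have ha1 := hf.2.2.1
  rcases le_total s a with h | h
  · have := (strictAntiOn_F hf) ⟨le_rfl, ha0.le⟩ ⟨hs.1.le, h⟩ hs.1
    rw [F_zero] at this
    linarith
  · exact (strictMonoOn_F hf) ⟨h, hs.2.le⟩ ⟨ha1.le, le_rfl⟩ hs.2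

theorem F_le_of_mem_Icc {f : ℝ → ℝ} {a : ℝ} (hf : Bistable f a) {s : ℝ}
    (hs : s ∈ Icc (0 : ℝ) 1) : F f a ≤ F f s := by
  have ha0 := hf.2.1
  have ha1 := hf.2.2.1
  rcases le_total s a with h | h
  · exact (strictAntiOn_F hf).antitoneOn ⟨hs.1, h⟩ ⟨ha0.le, le_rfl⟩ h
  · exact (strictMonoOn_F hf).monotoneOn ⟨le_rfl, ha1.le⟩ ⟨h, hs.2⟩ h

/-- The increasing profile from `θ ∈ (0, 1)` to `1`. -/
theorem exists_profile_to_one {f : ℝ → ℝ} {a : ℝ} (hf : Bistable f a) {θ : ℝ}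
    (hθ : θ ∈ Ioo (0 : ℝ) 1) :
    ∃ v w : ℝ → ℝ, v 0 = θ ∧ w 0 = √(2 * (F f 1 - F f θ)) ∧
      (∀ x, 0 ≤ x → HasDerivAt v (w x) x) ∧
      (∀ x, 0 ≤ x → HasDerivAt w (-f (v x)) x) ∧
      (∀ x, 0 ≤ x → v x ∈ Ioo 0 1) ∧ Tendsto v atTop (𝓝 1) := by
  obtain ⟨K, hK⟩ := exists_F_sub_le_sq hf.1 (right_mem_Icc.2 zero_le_one) hf.2.2.2.2.2.1
  exact exists_monotone_profile hθ.1 hθ.2 (hasDerivAt_F hf.1.continuous)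
    (fun s hs => F_lt_F_one hf hs) (fun s hs => hK s ⟨hθ.1.le.trans hs.1, hs.2.le⟩)

/-- The decreasing profile from `θ ∈ (0, a]` to `0`. -/
theorem exists_profile_to_zero {f : ℝ → ℝ} {a : ℝ} (hf : Bistable f a) {θ : ℝ}
    (hθ : θ ∈ Ioc 0 a) :
    ∃ v w : ℝ → ℝ, v 0 = θ ∧ w 0 = -√(2 * (-F f θ)) ∧
      (∀ x, 0 ≤ x → HasDerivAt v (w x) x) ∧
      (∀ x, 0 ≤ x → HasDerivAt w (-f (v x)) x) ∧
      (∀ x, 0 ≤ x → v x ∈ Ioo 0 1) ∧ Tendsto v atTop (𝓝 0) := by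
  have ha0 := hf.2.1
  have ha1 := hf.2.2.1
  have hFc := hasDerivAt_F hf.1.continuous
  have hneg : ∀ s ∈ Ioc 0 a, F f s < 0 := fun s hs => by
    have := (strictAntiOn_F hf) ⟨le_rfl, ha0.le⟩ ⟨hs.1.le, hs.2⟩ hs.1
    rwa [F_zero] at this
  obtain ⟨b, hab, hb1, hb⟩ : ∃ b, a < b ∧ b < 1 ∧ F f b < 0 := by
    have h1 : ∀ᶠ s in 𝓝[>] a, F f s < 0 :=
      nhdsWithin_le_nhds ((hFc a).continuousAt.eventually_lt continuousAt_const
        (hneg a ⟨ha0, le_rfl⟩))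
    obtain ⟨b, hb, hb'⟩ := (h1.and (Ioo_mem_nhdsGT ha1)).exists
    exact ⟨b, hb'.1, hb'.2, hb⟩
  obtain ⟨K, hK⟩ := exists_F_sub_le_sq hf.1 (left_mem_Icc.2 zero_le_one) hf.2.2.2.1
  obtain ⟨v, w, hv0, hw0, hv, hw, hm, hlim⟩ := exists_monotone_profile
    (G := fun s => F f (-s)) (h := fun s => -f (-s)) (α := -b) (θ := -θ) (β := 0) (K := K)
    (by linarith [hθ.2]) (by linarith [hθ.1])
    (fun s => ((hFc (-s)).comp s (hasDerivAt_neg s)).congr_deriv (by ring))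
    (fun s hs => by
      simp only [neg_zero, F_zero]
      rcases le_total (-s) a with h | h
      · exact hneg _ ⟨by linarith [hs.2], h⟩
      · exact ((strictMonoOn_F hf).monotoneOn ⟨h, by linarith [hs.1]⟩ ⟨hab.le, hb1.le⟩
          (by linarith [hs.1])).trans_lt hb)
    (fun s hs => by
      have := hK (-s) ⟨by linarith [hs.2], by linarith [hs.1, hθ.2]⟩
      simpa using this)
  refine ⟨fun x => -v x, fun x => -w x, by simp [hv0], by simp [hw0, F_zero],
    fun x hx => (hv x hx).neg, fun x hx => (hw x hx).neg.congr_deriv (by simp),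
    fun x hx => ⟨by linarith [(hm x hx).2], by linarith [(hm x hx).1]⟩, ?_⟩
  simpa using hlim.neg

/-- Sharp blocking criterion on a star graph with edge thicknesses `ρ`:
a blocking stationary solution (tending to 1 along edge `i` and to 0 along all
other edges, continuous at the junction and satisfying the weighted Kirchhoff
condition) exists iff `F(1) + (R_i² − 1)F(a) ≤ 0`, where
`R_i = (Σ_{k≠i} ρ_k)/ρ_i`. -/
theorem star_graph_blocking_criterion (f : ℝ → ℝ) (a : ℝ) (hf : Bistable f a)
    (N : ℕ) (hN : 2 ≤ N) (ρ : Fin N → ℝ) (hρ : ∀ j, 0 < ρ j) (i : Fin N) :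
    (∃ v : Fin N → ℝ → ℝ,
      (∀ j, ContinuousOn (v j) (Ici 0)) ∧
      (∀ j, ContDiffOn ℝ 2 (v j) (Ici 0)) ∧
      (∀ j, ∀ x : ℝ, 0 ≤ x →
        derivWithin (derivWithin (v j) (Ici 0)) (Ici 0) x + f (v j x) = 0) ∧
      (∀ j, ∀ x : ℝ, 0 ≤ x → 0 < v j x ∧ v j x < 1) ∧
      (∀ j k, v j 0 = v k 0) ∧
      (∑ j, ρ j * derivWithin (v j) (Ici 0) 0) = 0 ∧
      Tendsto (v i) atTop (𝓝 1) ∧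
      (∀ j, j ≠ i → Tendsto (v j) atTop (𝓝 0))) ↔
    F f 1 + (((∑ k ∈ Finset.univ.filter (· ≠ i), ρ k) / ρ i)^2 - 1) * F f a ≤ 0 := by
  have ha0 := hf.2.1
  have ha1 := hf.2.2.1
  have hFd := hasDerivAt_F hf.1.continuous
  have hF1 : 0 < F f 1 := hf.2.2.2.2.2.2.2.2.2.2.2
  have hρi := hρ i
  set S := ∑ k ∈ Finset.univ.filter (· ≠ i), ρ k with hS
  have hS0 : 0 ≤ S := Finset.sum_nonneg fun k _ => (hρ k).le
  have hsplit : ∀ z : Fin N → ℝ,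
      ∑ j, z j = z i + ∑ j ∈ Finset.univ.filter (· ≠ i), z j := fun z => by
    rw [Finset.filter_ne', Finset.add_sum_erase _ _ (Finset.mem_univ i)]
  constructor
  · rintro ⟨v, -, hC2, hode, hbd, hjunc, hkir, hlim1, hlim0⟩
    have hslope : ∀ j ℓ, Tendsto (v j) atTop (𝓝 ℓ) →
        derivWithin (v j) (Ici 0) 0 ^ 2 = 2 * (F f ℓ - F f (v i 0)) := by
      intro j ℓ hl
      have hd : ContDiffOn ℝ 1 (derivWithin (v j) (Ici 0)) (Ici 0) :=
        (hC2 j).derivWithin (uniqueDiffOn_Ici 0) (by norm_num)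
      rw [hjunc i j]
      refine sq_slope_eq_of_tendsto hFd (fun x hx =>
        ((hC2 j).differentiableOn two_ne_zero x hx).hasDerivWithinAt) (fun x hx => ?_) hl
      refine ((hd.differentiableOn one_ne_zero x hx).hasDerivWithinAt).congr_deriv ?_
      linarith [hode j x hx]
    have hi := hslope i 1 hlim1
    have hj : ∀ j, j ≠ i → |derivWithin (v j) (Ici 0) 0| = √(2 * -F f (v i 0)) := by
      intro j hji
      rw [← Real.sqrt_sq_eq_abs, hslope j 0 (hlim0 j hji), F_zero, zero_sub]
    obtain ⟨k, hk⟩ : ∃ k, k ≠ i := by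
      have : Nontrivial (Fin N) := Fin.nontrivial_iff_two_le.2 hN
      exact exists_ne i
    have hFθ : 0 ≤ 2 * -F f (v i 0) := by
      have := hslope k 0 (hlim0 k hk)
      rw [F_zero, zero_sub] at this
      exact this ▸ sq_nonneg _
    rw [hsplit] at hkir
    have hle : |ρ i * derivWithin (v i) (Ici 0) 0| ≤ S * √(2 * -F f (v i 0)) := by
      rw [eq_neg_of_add_eq_zero_left hkir, abs_neg, hS, Finset.sum_mul]
      refine (Finset.abs_sum_le_sum_abs _ _).trans (Finset.sum_le_sum fun j hjm => ?_)
      rw [abs_mul, abs_of_pos (hρ j), hj j (Finset.mem_filter.1 hjm).2]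
    have hsq := pow_le_pow_left₀ (abs_nonneg _) hle 2
    rw [sq_abs, mul_pow, mul_pow, Real.sq_sqrt hFθ, hi] at hsq
    have hR : (F f 1 - F f (v i 0)) ≤ (S / ρ i) ^ 2 * -F f (v i 0) := by
      rw [div_pow, div_mul_eq_mul_div, le_div_iff₀ (by positivity)]
      linarith
    have hmin : F f a ≤ F f (v i 0) :=
      F_le_of_mem_Icc hf ⟨(hbd i 0 le_rfl).1.le, (hbd i 0 le_rfl).2.le⟩
    have hR1 : 0 ≤ (S / ρ i) ^ 2 - 1 := by
      by_contra! hlt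
      nlinarith
    nlinarith
  · intro hcrit
    have hcont : ContinuousOn (fun s => F f 1 + ((S / ρ i) ^ 2 - 1) * F f s) (Icc 0 a) :=
      fun s _ => (((hFd s).continuousAt.const_mul _).const_add _).continuousWithinAt
    obtain ⟨θ, hθ, hθ0⟩ := intermediate_value_Icc' ha0.le hcont
      (show (0 : ℝ) ∈ Icc _ _ from ⟨hcrit, by simp [F_zero, hF1.le]⟩)
    simp only at hθ0
    have hθpos : 0 < θ := by
      refine hθ.1.lt_of_ne ?_
      rintro rfl
      rw [F_zero] at hθ0
      linarith
    obtain ⟨u, u', hu0, hu'0, hu, hu', hum, hulim⟩ :=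
      exists_profile_to_one hf ⟨hθpos, hθ.2.trans_lt ha1⟩
    obtain ⟨z, z', hz0, hz'0, hz, hz', hzm, hzlim⟩ := exists_profile_to_zero hf ⟨hθpos, hθ.2⟩
    obtain ⟨hu2, hus, hue⟩ := derivWithin_eq_and_contDiffOn_two hf.1.continuous hu hu'
    obtain ⟨hz2, hzs, hze⟩ := derivWithin_eq_and_contDiffOn_two hf.1.continuous hz hz'
    have hval : ∀ j, (if j = i then u else z) 0 = θ := by
      intro j
      split_ifs <;> assumption
    refine ⟨fun j => if j = i then u else z, ?_, ?_, ?_, ?_, ?_, ?_, ?_, ?_⟩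
    · intro j
      dsimp only
      split_ifs
      exacts [hu2.continuousOn, hz2.continuousOn]
    · intro j
      dsimp only
      split_ifs
      exacts [hu2, hz2]
    · intro j
      dsimp only
      split_ifs
      exacts [hue, hze]
    · intro j
      dsimp only
      split_ifs
      exacts [hum, hzm]
    · intro j k
      exact (hval j).trans (hval k).symm
    · have hsum : ∑ j ∈ Finset.univ.filter (· ≠ i),
          ρ j * derivWithin (if j = i then u else z) (Ici 0) 0 = S * z' 0 := by
        rw [hS, Finset.sum_mul]
        refine Finset.sum_congr rfl fun j hj => ?_
        rw [if_neg (Finset.mem_filter.1 hj).2, hzs]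
      rw [hsplit, hsum]
      simp only [if_true]
      rw [hus, hu'0, hz'0]
      have h1 : 2 * (F f 1 - F f θ) = (S / ρ i) ^ 2 * (2 * -F f θ) := by linarith
      rw [h1, Real.sqrt_mul (sq_nonneg _), Real.sqrt_sq (by positivity)]
      field_simp
      ring
    · simpa using hulim
    · intro j hj
      simpa [hj] using hzlim
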